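/- arXiv:2005.08779 — 2 statements merged into one kernel-verified Lean document; each statement's English description precedes it below -/
import Mathlib

section
/- The transpose Tr provides a bijection between the isomorphism classes of Nunke left A-modules and the isomorphism classes of reduced ∞-torsionfree right A-modules of projective dimension at most 1. -/
/-!
Common background: `A` is an artin algebra (an algebra over a commutative artinian
ring `k`, finitely generated as `k`-module).  Left `A`-modules are `Module A M`;
right `A`-modules are `Module Aᵐᵒᵖ N`.  `Dl A M = Hom_A(M,A)` is the `A`-dual of a
left module (a right module) and `Dr A N` the dual of a right module (a left module);
`evalL A M : M → M**` is the canonical evaluation map `φ_M`.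
-/

open CategoryTheory LinearMap

universe u

section Preliminaries

variable (A : Type u) [Ring A]

/-- The `A`-dual of a left `A`-module: `M* = Hom_A(M, A)`, a right `A`-module. -/
abbrev Dl (M : Type u) [AddCommGroup M] [Module A M] : Type u := M →ₗ[A] A

/-- The `A`-dual of a right `A`-module: a left `A`-module. -/
abbrev Dr (N : Type u) [AddCommGroup N] [Module Aᵐᵒᵖ N] : Type u := N →ₗ[Aᵐᵒᵖ] A

variable {A}

/-- The dual of a map of left modules. -/
def dualMapL {M N : Type u} [AddCommGroup M] [Module A M] [AddCommGroup N] [Module A N]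
    (g : M →ₗ[A] N) : Dl A N →ₗ[Aᵐᵒᵖ] Dl A M where
  toFun h := h.comp g
  map_add' h₁ h₂ := by ext; simp
  map_smul' a h := by ext; simp

/-- The dual of a map of right modules. -/
def dualMapR {M N : Type u} [AddCommGroup M] [Module Aᵐᵒᵖ M] [AddCommGroup N] [Module Aᵐᵒᵖ N]
    (g : M →ₗ[Aᵐᵒᵖ] N) : Dr A N →ₗ[A] Dr A M where
  toFun h := h.comp g
  map_add' h₁ h₂ := by ext; simp
  map_smul' a h := by ext; simp

variable (A)

/-- The canonical evaluation map `φ_M : M → M**` for a left module `M`. -/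
def evalL (M : Type u) [AddCommGroup M] [Module A M] : M →ₗ[A] Dr A (Dl A M) where
  toFun m :=
    { toFun := fun f => f m
      map_add' := fun f g => rfl
      map_smul' := fun a f => rfl }
  map_add' m m' := by ext f; simp
  map_smul' a m := by ext f; simp

/-- The canonical evaluation map `φ_N : N → N**` for a right module `N`. -/
def evalR (N : Type u) [AddCommGroup N] [Module Aᵐᵒᵖ N] : N →ₗ[Aᵐᵒᵖ] Dl A (Dr A N) where
  toFun n :=
    { toFun := fun f => f n
      map_add' := fun f g => rfl
      map_smul' := fun a f => rfl }
  map_add' n n' := by ext f; simp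
  map_smul' a n := by ext f; simp

/-- The radical of a module: the intersection of all maximal submodules. -/
def radM (M : Type u) [AddCommGroup M] [Module A M] : Submodule A M :=
  sInf {N : Submodule A M | IsCoatom N}

/-- A module is *reduced* if it has no nonzero projective direct summand. -/
def Reduced (M : Type u) [AddCommGroup M] [Module A M] : Prop :=
  ∀ N N' : Submodule A M, IsCompl N N' → Module.Projective A N → N = ⊥

/-- Vanishing of `Ext^i_A(M, N)`. -/
def extZero (M N : Type u) [AddCommGroup M] [Module A M] [AddCommGroup N] [Module A N]
    (i : ℕ) : Prop :=
  Limits.IsZero (((Ext ℤ (ModuleCat.{u} A) i).obj (Opposite.op (ModuleCat.of A M))).obj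
    (ModuleCat.of A N))

/-- A left module `M` is semi-Gorenstein-projective if `Ext^i_A(M, A) = 0` for all `i ≥ 1`. -/
def sGp (M : Type u) [AddCommGroup M] [Module A M] : Prop :=
  ∀ i : ℕ, 1 ≤ i → extZero A M A i

/-- Semi-Gorenstein-projectivity for right modules, with `A` as right regular module. -/
def sGpR (N : Type u) [AddCommGroup N] [Module Aᵐᵒᵖ N] : Prop :=
  ∀ i : ℕ, 1 ≤ i → extZero Aᵐᵒᵖ N A i

/-- `e : P → M` is a projective cover: `P` is a finitely generated projective module,
`e` is surjective and `ker e ⊆ rad P`. -/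
def IsProjCover {P M : Type u} [AddCommGroup P] [Module A P] [AddCommGroup M] [Module A M]
    (e : P →ₗ[A] M) : Prop :=
  Module.Projective A P ∧ Module.Finite A P ∧ Function.Surjective e ∧ ker e ≤ radM A P

/-- `P₁ →f P₀ →e M → 0` is a minimal projective presentation of `M`. -/
def IsMinPres {P₁ P₀ M : Type u} [AddCommGroup P₁] [Module A P₁] [AddCommGroup P₀] [Module A P₀]
    [AddCommGroup M] [Module A M] (f : P₁ →ₗ[A] P₀) (e : P₀ →ₗ[A] M) : Prop :=
  IsProjCover A e ∧ range f = ker e ∧ Module.Projective A P₁ ∧ Module.Finite A P₁ ∧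
    ker f ≤ radM A P₁

/-- A minimal projective resolution `⋯ → P₁ → P₀ → M → 0` (ℕ-indexed). -/
def IsMinProjRes (P : ℕ → Type u) [∀ n, AddCommGroup (P n)] [∀ n, Module A (P n)]
    {M : Type u} [AddCommGroup M] [Module A M]
    (f : ∀ n, P (n+1) →ₗ[A] P n) (e : P 0 →ₗ[A] M) : Prop :=
  (∀ n, Module.Projective A (P n)) ∧ (∀ n, Module.Finite A (P n)) ∧
    Function.Surjective e ∧ range (f 0) = ker e ∧ (∀ n, range (f (n+1)) = ker (f n)) ∧
    ker e ≤ radM A (P 0) ∧ (∀ n, ker (f n) ≤ radM A (P (n+1)))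

section ZComplex

variable (P : ℤ → Type u) [∀ i, AddCommGroup (P i)] [∀ i, Module A (P i)]
  (g : ∀ i : ℤ, P i →ₗ[A] P (i-1))

/-- `(P_i, g_i : P_i → P_{i-1})` is a complex. -/
def IsComplexZ : Prop := ∀ i : ℤ, (g (i-1)).comp (g i) = 0

/-- A complex is minimal if each image lies in the radical. -/
def IsMinimalZ : Prop := ∀ i : ℤ, range (g i) ≤ radM A (P (i-1))

/-- A complex of (finitely generated) projective modules. -/
def IsProjComplexZ : Prop := ∀ i : ℤ, Module.Projective A (P i) ∧ Module.Finite A (P i)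

/-- Exactness at position `i - 1`, i.e. `H_{i-1}(P_•) = 0`. -/
def ExactAtPred (i : ℤ) : Prop := range (g i) = ker (g (i-1))

/-- Acyclicity of the `A`-dual complex `P_•^*`. -/
def DualAcyclicZ : Prop :=
  ∀ i : ℤ, range (dualMapL (g (i-1))) = ker (dualMapL (g i))

/-- The homology of the complex at position `i - 1`. -/
abbrev HomologyAtPred (i : ℤ) : Type u :=
  ↥(ker (g (i-1))) ⧸ (Submodule.comap (ker (g (i-1))).subtype (range (g i)))

end ZComplex

/-- `Z` is (a representative of) the transpose `Tr M` of the left module `M`. -/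
def IsTrL (M : Type u) [AddCommGroup M] [Module A M]
    (Z : Type u) [AddCommGroup Z] [Module Aᵐᵒᵖ Z] : Prop :=
  ∃ (P₁ P₀ : ModuleCat.{u} A) (f : P₁ →ₗ[A] P₀) (e : P₀ →ₗ[A] M),
    IsMinPres A f e ∧ Nonempty (Z ≃ₗ[Aᵐᵒᵖ] (Dl A P₁ ⧸ range (dualMapL f)))

/-- `M` is (a representative of) the transpose `Tr Z` of the right module `Z`. -/
def IsTrR (Z : Type u) [AddCommGroup Z] [Module Aᵐᵒᵖ Z]
    (M : Type u) [AddCommGroup M] [Module A M] : Prop :=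
  ∃ (Q₁ Q₀ : ModuleCat.{u} Aᵐᵒᵖ) (d : Q₁ →ₗ[Aᵐᵒᵖ] Q₀) (c : Q₀ →ₗ[Aᵐᵒᵖ] Z),
    IsMinPres Aᵐᵒᵖ d c ∧ Nonempty (M ≃ₗ[A] (Dr A Q₁ ⧸ range (dualMapR d)))

/-- `W` is (a representative of) the syzygy `Ω M` of the left module `M`. -/
def IsSyzL (W M : Type u) [AddCommGroup W] [Module A W] [AddCommGroup M] [Module A M] : Prop :=
  ∃ (P : ModuleCat.{u} A) (e : P →ₗ[A] M),
    IsProjCover A e ∧ Nonempty (W ≃ₗ[A] ker e)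

/-- `W` is (a representative of) the syzygy `Ω Z` of the right module `Z`. -/
def IsSyzR (W Z : Type u) [AddCommGroup W] [Module Aᵐᵒᵖ W] [AddCommGroup Z] [Module Aᵐᵒᵖ Z] :
    Prop :=
  ∃ (Q : ModuleCat.{u} Aᵐᵒᵖ) (c : Q →ₗ[Aᵐᵒᵖ] Z),
    IsProjCover Aᵐᵒᵖ c ∧ Nonempty (W ≃ₗ[Aᵐᵒᵖ] ker c)

/-- `W` is a second syzygy `Ω² M`. -/
def IsSyz2L (W M : Type u) [AddCommGroup W] [Module A W] [AddCommGroup M] [Module A M] : Prop :=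
  ∃ (V : ModuleCat.{u} A), IsSyzL A V M ∧ IsSyzL A W V

/-- `W` is a second syzygy `Ω² Z` of a right module. -/
def IsSyz2R (W Z : Type u) [AddCommGroup W] [Module Aᵐᵒᵖ W] [AddCommGroup Z] [Module Aᵐᵒᵖ Z] :
    Prop :=
  ∃ (V : ModuleCat.{u} Aᵐᵒᵖ), IsSyzR A V Z ∧ IsSyzR A W V

/-- A right module `Z` is ∞-torsionfree if its transpose is semi-Gorenstein-projective. -/
def InfTfR (Z : Type u) [AddCommGroup Z] [Module Aᵐᵒᵖ Z] : Prop :=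
  ∃ (M : ModuleCat.{u} A), IsTrR A Z M ∧ sGp A M

/-- A left module `M` is ∞-torsionfree if its transpose is semi-Gorenstein-projective. -/
def InfTfL (M : Type u) [AddCommGroup M] [Module A M] : Prop :=
  ∃ (Z : ModuleCat.{u} Aᵐᵒᵖ), IsTrL A M Z ∧ sGpR A Z

/-- Projective dimension at most `n` (for objects of `ModuleCat A`). -/
def projDimLEcat : ℕ → ModuleCat.{u} A → Prop
  | 0, M => Module.Projective A M
  | (n+1), M => ∃ (P : ModuleCat.{u} A) (e : P →ₗ[A] M),
      Module.Projective A P ∧ Module.Finite A P ∧ Function.Surjective e ∧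
        projDimLEcat n (ModuleCat.of A (ker e))

/-- Projective dimension at most `n`. -/
def projDimLE (M : Type u) [AddCommGroup M] [Module A M] (n : ℕ) : Prop :=
  projDimLEcat A n (ModuleCat.of A M)

/-- A Nunke module: a semi-Gorenstein-projective module `M` with `M* = 0`. -/
def NunkeL (M : Type u) [AddCommGroup M] [Module A M] : Prop :=
  sGp A M ∧ ∀ f : Dl A M, f = 0

end Preliminaries


/-- (Finitely generated) Nunke modules. -/
def NunkeClass (A : Type u) [Ring A] (M : Type u) [AddCommGroup M] [Module A M] : Prop :=
  Module.Finite A M ∧ NunkeL A M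

/-- Reduced ∞-torsionfree right modules of projective dimension at most 1. -/
def TfPd1Class (A : Type u) [Ring A] (Z : Type u) [AddCommGroup Z] [Module Aᵐᵒᵖ Z] : Prop :=
  Module.Finite Aᵐᵒᵖ Z ∧ Reduced Aᵐᵒᵖ Z ∧ InfTfR A Z ∧ projDimLE Aᵐᵒᵖ Z 1

section GenericModules

variable {R : Type u} [Ring R]

theorem exists_finite_dual_basis (P : Type u) [AddCommGroup P] [Module R P]
    [Module.Projective R P] [Module.Finite R P] :
    ∃ (n : ℕ) (b : Fin n → P) (φ : Fin n → P →ₗ[R] R), ∀ p, ∑ i, φ i p • b i = p := by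
  obtain ⟨n, π, hπ⟩ := Module.Finite.exists_fin' R P
  obtain ⟨s, hs⟩ := Module.projective_lifting_property π LinearMap.id hπ
  refine ⟨n, fun i => π (Pi.single i 1), fun i => (LinearMap.proj i).comp s, fun p => ?_⟩
  have h : π (s p) = p := LinearMap.congr_fun hs p
  conv_rhs => rw [← h, ← Finset.univ_sum_single (s p)]
  simp only [map_sum, LinearMap.comp_apply, LinearMap.proj_apply, ← map_smul]
  refine Finset.sum_congr rfl fun i _ => ?_
  rw [← Pi.single_smul, smul_eq_mul, mul_one]

theorem projective_finite_of_dual_basis {P : Type u} [AddCommGroup P] [Module R P]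
    {n : ℕ} (b : Fin n → P) (φ : Fin n → P →ₗ[R] R) (h : ∀ p, ∑ i, φ i p • b i = p) :
    Module.Projective R P ∧ Module.Finite R P := by
  have hc : (Fintype.linearCombination R b).comp (LinearMap.pi φ) = LinearMap.id := by
    ext p
    simpa [Fintype.linearCombination_apply] using h p
  refine ⟨Module.Projective.of_split _ _ hc, Module.Finite.of_surjective
    (Fintype.linearCombination R b) fun p => ⟨LinearMap.pi φ p, LinearMap.congr_fun hc p⟩⟩

theorem eq_top_of_sup_radM_eq_top {P : Type u} [AddCommGroup P] [Module R P] [Module.Finite R P]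
    {N K : Submodule R P} (hK : K ≤ radM R P) (h : N ⊔ K = ⊤) : N = ⊤ := by
  rcases eq_top_or_exists_le_coatom N with h' | ⟨C, hC, hN⟩
  · exact h'
  · exact absurd (top_le_iff.1 (h ▸ sup_le hN (hK.trans (sInf_le hC)))) hC.1

theorem surjective_of_comp_projCover {P P' M : Type u} [AddCommGroup P] [Module R P]
    [AddCommGroup P'] [Module R P'] [AddCommGroup M] [Module R M] [Module.Finite R P']
    {e' : P' →ₗ[R] M} (hk : ker e' ≤ radM R P') {s : P →ₗ[R] P'}
    (hs : Function.Surjective (e'.comp s)) : Function.Surjective s := by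
  rw [← LinearMap.range_eq_top]
  refine eq_top_of_sup_radM_eq_top hk (top_le_iff.1 fun p _ => ?_)
  obtain ⟨q, hq⟩ := hs (e' p)
  refine Submodule.mem_sup.2 ⟨s q, ⟨q, rfl⟩, p - s q, ?_, by abel⟩
  rw [LinearMap.mem_ker, map_sub, sub_eq_zero, ← hq, LinearMap.comp_apply]

theorem exists_equiv_of_isProjCover [IsNoetherianRing R] {P P' M : Type u}
    [AddCommGroup P] [Module R P] [AddCommGroup P'] [Module R P'] [AddCommGroup M] [Module R M]
    {e : P →ₗ[R] M} {e' : P' →ₗ[R] M} (h : IsProjCover R e) (h' : IsProjCover R e') :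
    ∃ β : P ≃ₗ[R] P', ∀ p, e' (β p) = e p := by
  obtain ⟨_, _, hs, hk⟩ := h
  obtain ⟨_, _, hs', hk'⟩ := h'
  obtain ⟨s, hes⟩ := Module.projective_lifting_property e' e hs'
  obtain ⟨t, het⟩ := Module.projective_lifting_property e e' hs
  have s_surj : Function.Surjective s := surjective_of_comp_projCover hk' (by rwa [hes])
  have t_surj : Function.Surjective t := surjective_of_comp_projCover hk (by rwa [het])
  have inj : Function.Injective (t.comp s) :=
    IsNoetherian.injective_of_surjective_endomorphism _ (t_surj.comp s_surj)
  exact ⟨LinearEquiv.ofBijective s ⟨Function.Injective.of_comp inj, s_surj⟩,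
    fun p => LinearMap.congr_fun hes p⟩

theorem exists_equiv_of_isMinPres [IsNoetherianRing R] {P₁ P₀ P₁' P₀' M : Type u}
    [AddCommGroup P₁] [Module R P₁] [AddCommGroup P₀] [Module R P₀]
    [AddCommGroup P₁'] [Module R P₁'] [AddCommGroup P₀'] [Module R P₀']
    [AddCommGroup M] [Module R M] {f : P₁ →ₗ[R] P₀} {e : P₀ →ₗ[R] M}
    {f' : P₁' →ₗ[R] P₀'} {e' : P₀' →ₗ[R] M} (h : IsMinPres R f e) (h' : IsMinPres R f' e') :
    ∃ (α : P₁ ≃ₗ[R] P₁') (β : P₀ ≃ₗ[R] P₀'), ∀ p, β (f p) = f' (α p) := by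
  obtain ⟨hc, hr, hp, hf, hk⟩ := h
  obtain ⟨hc', hr', hp', hf', hk'⟩ := h'
  obtain ⟨β, hβ⟩ := exists_equiv_of_isProjCover hc hc'
  let g : P₁ →ₗ[R] ker e' := LinearMap.codRestrict _ (β.toLinearMap.comp f) fun p => by
    have : f p ∈ ker e := hr ▸ ⟨p, rfl⟩
    simpa [hβ] using this
  let g' : P₁' →ₗ[R] ker e' := LinearMap.codRestrict _ f' fun p => hr' ▸ ⟨p, rfl⟩
  have hg : IsProjCover R g := by
    refine ⟨hp, hf, fun ⟨y, hy⟩ => ?_, ?_⟩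
    · have : β.symm y ∈ ker e := by
        rw [LinearMap.mem_ker, ← hβ, LinearEquiv.apply_symm_apply]
        exact hy
      rw [← hr] at this
      obtain ⟨x, hx⟩ := this
      exact ⟨x, Subtype.ext (by simp [g, hx])⟩
    · rw [LinearMap.ker_codRestrict, LinearEquiv.ker_comp]
      exact hk
  have hg' : IsProjCover R g' := by
    refine ⟨hp', hf', fun ⟨y, hy⟩ => ?_, ?_⟩
    · rw [← hr'] at hy
      obtain ⟨x, hx⟩ := hy
      exact ⟨x, Subtype.ext (by simp [g', hx])⟩
    · rw [LinearMap.ker_codRestrict]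
      exact hk'
  obtain ⟨α, hα⟩ := exists_equiv_of_isProjCover hg hg'
  exact ⟨α, β, fun p => (congrArg Subtype.val (hα p)).symm⟩

theorem projective_ker_of_projDimLE_one {Q Z : Type u} [AddCommGroup Q] [Module R Q]
    [AddCommGroup Z] [Module R Z] [Module.Projective R Q] {c : Q →ₗ[R] Z}
    (hc : Function.Surjective c) (h : projDimLE R Z 1) : Module.Projective R (ker c) := by
  obtain ⟨P, e, _, -, he, hK⟩ := h
  have : Module.Projective R (ker e) := hK
  obtain ⟨s, hs⟩ := Module.projective_lifting_property c e hc
  obtain ⟨t, ht⟩ := Module.projective_lifting_property e c he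
  replace hs : ∀ x, c (s x) = e x := fun x => LinearMap.congr_fun hs x
  replace ht : ∀ x, e (t x) = c x := fun x => LinearMap.congr_fun ht x
  let t' : ker c →ₗ[R] ker e := t.restrict fun x hx => by
    rw [LinearMap.mem_ker, ht]
    exact hx
  let s' : ker e →ₗ[R] ker c := s.restrict fun x hx => by
    rw [LinearMap.mem_ker, hs]
    exact hx
  let v : Q →ₗ[R] ker c := LinearMap.codRestrict _ (LinearMap.id - s.comp t) fun x => by
    simp [hs, ht]
  refine Module.Projective.of_split (t'.prod (ker c).subtype) (s'.coprod v) ?_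
  ext x
  simp [t', s', v]

/-- In a minimal presentation of a module of projective dimension at most one, the first map is
injective. -/
theorem ker_eq_bot_of_isMinPres_of_projDimLE_one {Q₁ Q₀ Z : Type u}
    [AddCommGroup Q₁] [Module R Q₁] [AddCommGroup Q₀] [Module R Q₀] [AddCommGroup Z] [Module R Z]
    {d : Q₁ →ₗ[R] Q₀} {c : Q₀ →ₗ[R] Z} (h : IsMinPres R d c) (hZ : projDimLE R Z 1) :
    ker d = ⊥ := by
  obtain ⟨⟨_, _, hs, -⟩, hr, _, _, hk⟩ := h
  have : Module.Projective R (range d) := hr ▸ projective_ker_of_projDimLE_one hs hZ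
  obtain ⟨s, hs⟩ := Module.projective_lifting_property d.rangeRestrict LinearMap.id
    d.surjective_rangeRestrict
  have hs_top : Function.Surjective s := by
    refine surjective_of_comp_projCover (e' := d.rangeRestrict) ?_ ?_
    · rwa [LinearMap.ker_rangeRestrict]
    · rw [hs]
      exact Function.surjective_id
  rw [eq_bot_iff]
  intro x hx
  obtain ⟨y, rfl⟩ := hs_top x
  have h1 : d.rangeRestrict (s y) = y := LinearMap.congr_fun hs y
  have h2 : y = 0 := by
    rw [← h1]
    exact Subtype.ext hx
  simp [h2]

theorem sGp_of_equiv {M M' : Type u} [AddCommGroup M] [Module R M] [AddCommGroup M'] [Module R M']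
    (e : M ≃ₗ[R] M') (h : sGp R M) : sGp R M' := fun i hi =>
  (h i hi).of_iso (((Ext ℤ (ModuleCat.{u} R) i).mapIso e.toModuleIso.op).app _)

theorem isNilpotent_mul_comm {a b : R} (h : IsNilpotent (a * b)) : IsNilpotent (b * a) := by
  obtain ⟨n, hn⟩ := h
  refine ⟨n + 1, ?_⟩
  have h : ∀ m, a * (b * a) ^ m = (a * b) ^ m * a := fun m =>
    (SemiconjBy.pow_right (show SemiconjBy a (b * a) (a * b) from (mul_assoc a b a).symm) m)
  rw [pow_succ', mul_assoc, h, hn, zero_mul, mul_zero]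

theorem mem_jacobson_iff_isNilpotent [IsArtinianRing R] {a : R} :
    a ∈ Ring.jacobson R ↔ ∀ y, IsNilpotent (y * a) := by
  constructor
  · intro ha y
    obtain ⟨n, hn⟩ := IsSemiprimaryRing.isNilpotent (R := R)
    refine ⟨n, ?_⟩
    have := Ideal.pow_mem_pow (Ideal.mul_mem_left _ y ha) n
    rwa [hn] at this
  · intro h
    rw [← Ideal.jacobson_bot, Ideal.mem_jacobson_iff]
    intro y
    obtain ⟨z, hz⟩ := ((h y).isUnit_add_one).exists_left_inv
    refine ⟨z, ?_⟩
    rw [Ideal.mem_bot, ← hz]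
    noncomm_ring

theorem op_mem_jacobson_iff [IsArtinianRing R] [IsArtinianRing Rᵐᵒᵖ] {a : R} :
    MulOpposite.op a ∈ Ring.jacobson Rᵐᵒᵖ ↔ a ∈ Ring.jacobson R := by
  rw [mem_jacobson_iff_isNilpotent, mem_jacobson_iff_isNilpotent]
  have key : ∀ b : R, IsNilpotent (MulOpposite.op b) ↔ IsNilpotent b := fun b => by
    simp [IsNilpotent, ← MulOpposite.op_pow]
  constructor
  · intro h y
    exact isNilpotent_mul_comm ((key _).1 (h (MulOpposite.op y)))
  · intro h y
    exact (key (a * y.unop)).2 (isNilpotent_mul_comm (h y.unop))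

/-- A homomorphism from a reduced module of finite length to the ring has nilpotent values. -/
theorem isNilpotent_of_reduced {Z : Type u} [AddCommGroup Z] [Module R Z] [IsArtinian R Z]
    [IsNoetherian R Z] (hZ : Reduced R Z) (ψ : Z →ₗ[R] R) (z : Z) : IsNilpotent (ψ z) := by
  let η : Module.End R Z := (LinearMap.toSpanSingleton R Z z).comp ψ
  have hη : ∀ n w, (η ^ (n + 1)) w = (ψ w * ψ z ^ n) • z := by
    intro n w
    induction n with
    | zero => simp [η]
    | succ n ih =>
      rw [pow_succ', Module.End.mul_apply, ih]
      simp [η, pow_succ, mul_smul]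
  obtain ⟨n, hn⟩ := Filter.eventually_atTop.1 η.eventually_isCompl_ker_pow_range_pow
  have hc := hn (n + 1) (Nat.le_succ n)
  have hinj : ∀ x ∈ range (η ^ (n + 1)), (η ^ (n + 1)) x = 0 → x = 0 := fun x hx h0 => by
    simpa using hc.disjoint.le_bot (show x ∈ ker (η ^ (n + 1)) ⊓ range (η ^ (n + 1)) from ⟨h0, hx⟩)
  have hproj : Module.Projective R (range (η ^ (n + 1))) := by
    let r : range (η ^ (n + 1)) →ₗ[R] range (η ^ (n + 1)) :=
      (η ^ (n + 1) * η).restrict fun x _ => ⟨η x, rfl⟩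
    have r_inj : Function.Injective r := by
      rw [← LinearMap.ker_eq_bot, eq_bot_iff]
      rintro ⟨_, w, rfl⟩ hx
      have hx' : (η ^ (n + 1)) (η ((η ^ (n + 1)) w)) = 0 := congrArg Subtype.val hx
      have h1 : η ((η ^ (n + 1)) w) = 0 := by
        refine hinj _ ⟨η w, ?_⟩ hx'
        rw [← Module.End.mul_apply, ← Module.End.mul_apply, ← pow_succ, ← pow_succ']
      refine Subtype.ext (hinj _ ⟨w, rfl⟩ ?_)
      rw [pow_succ, Module.End.mul_apply, ← pow_succ, h1, map_zero]
    let ρ := LinearEquiv.ofBijective r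
      (IsArtinian.bijective_of_injective_endomorphism r r_inj)
    refine Module.Projective.of_split (ψ.comp (range (η ^ (n + 1))).subtype)
      (ρ.symm.toLinearMap.comp
        ((η ^ (n + 1)).rangeRestrict.comp (LinearMap.toSpanSingleton R Z z))) ?_
    ext1 x
    exact ρ.symm_apply_eq.2 rfl
  have := hZ _ _ hc.symm hproj
  refine ⟨n + 1 + 1, ?_⟩
  have h0 : (η ^ (n + 1)) z = 0 := by
    have : (η ^ (n + 1)) z ∈ range (η ^ (n + 1)) := ⟨z, rfl⟩
    simp_all
  rw [hη] at h0
  have := congrArg ψ h0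
  rw [map_smul, map_zero, smul_eq_mul] at this
  rw [pow_succ, pow_succ']
  exact this

end GenericModules

section Duality

variable {A : Type u} [Ring A]

/-- The right regular module is the regular module over the opposite ring. -/
def opRegular (A : Type u) [Ring A] : A ≃ₗ[Aᵐᵒᵖ] Aᵐᵒᵖ where
  toFun := MulOpposite.op
  invFun := MulOpposite.unop
  map_add' _ _ := rfl
  map_smul' _ _ := rfl
  left_inv _ := rfl
  right_inv _ := rfl

theorem exists_finite_dual_basis_right (Q : Type u) [AddCommGroup Q] [Module Aᵐᵒᵖ Q]
    [Module.Projective Aᵐᵒᵖ Q] [Module.Finite Aᵐᵒᵖ Q] :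
    ∃ (n : ℕ) (b : Fin n → Q) (φ : Fin n → Dr A Q),
      ∀ q, ∑ i, MulOpposite.op (φ i q) • b i = q := by
  obtain ⟨n, b, φ, h⟩ := exists_finite_dual_basis (R := Aᵐᵒᵖ) Q
  exact ⟨n, b, fun i => (opRegular A).symm.toLinearMap.comp (φ i), h⟩

theorem projective_finite_of_dual_basis_right {Q : Type u} [AddCommGroup Q] [Module Aᵐᵒᵖ Q]
    {n : ℕ} (b : Fin n → Q) (φ : Fin n → Dr A Q)
    (h : ∀ q, ∑ i, MulOpposite.op (φ i q) • b i = q) :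
    Module.Projective Aᵐᵒᵖ Q ∧ Module.Finite Aᵐᵒᵖ Q :=
  projective_finite_of_dual_basis b (fun i => (opRegular A).toLinearMap.comp (φ i)) h

section Left

variable {P : Type u} [AddCommGroup P] [Module A P]

theorem sum_op_smul_dual_basis {n : ℕ} {b : Fin n → P} {φ : Fin n → Dl A P}
    (h : ∀ p, ∑ i, φ i p • b i = p) (g : Dl A P) : ∑ i, MulOpposite.op (g (b i)) • φ i = g := by
  ext p
  conv_rhs => rw [← h p]
  simp [LinearMap.sum_apply]

variable [Module.Projective A P] [Module.Finite A P]

variable (P) in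
theorem projective_finite_Dl : Module.Projective Aᵐᵒᵖ (Dl A P) ∧ Module.Finite Aᵐᵒᵖ (Dl A P) := by
  obtain ⟨n, b, φ, h⟩ := exists_finite_dual_basis (R := A) P
  exact projective_finite_of_dual_basis_right φ (fun i => evalL A P (b i))
    (sum_op_smul_dual_basis h)

variable (A P) in
theorem evalL_bijective : Function.Bijective (evalL A P) := by
  obtain ⟨n, b, φ, h⟩ := exists_finite_dual_basis (R := A) P
  constructor
  · rw [← LinearMap.ker_eq_bot, eq_bot_iff]
    intro p hp
    have hp' : ∀ g : Dl A P, g p = 0 := fun g => LinearMap.congr_fun (LinearMap.mem_ker.1 hp) g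
    rw [Submodule.mem_bot, ← h p]
    simp [hp']
  · intro x
    refine ⟨∑ i, x (φ i) • b i, ?_⟩
    ext g
    conv_rhs => rw [← sum_op_smul_dual_basis h g]
    simp [evalL]

theorem mem_radM_Dl [IsArtinianRing A] [IsArtinianRing Aᵐᵒᵖ] {g : Dl A P}
    (hg : ∀ p, g p ∈ Ring.jacobson A) : g ∈ radM Aᵐᵒᵖ (Dl A P) := by
  obtain ⟨n, b, φ, h⟩ := exists_finite_dual_basis (R := A) P
  rw [← sum_op_smul_dual_basis h g]
  exact Submodule.sum_mem _ fun i _ => Ring.jacobson_smul_top_le Aᵐᵒᵖ (Dl A P)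
    (Submodule.smul_mem_smul (op_mem_jacobson_iff.2 (hg _)) trivial)

end Left

section Right

variable {Q : Type u} [AddCommGroup Q] [Module Aᵐᵒᵖ Q]

theorem sum_smul_dual_basis {n : ℕ} {b : Fin n → Q} {φ : Fin n → Dr A Q}
    (h : ∀ q, ∑ i, MulOpposite.op (φ i q) • b i = q) (g : Dr A Q) : ∑ i, g (b i) • φ i = g := by
  ext q
  conv_rhs => rw [← h q]
  simp [LinearMap.sum_apply]

variable [Module.Projective Aᵐᵒᵖ Q] [Module.Finite Aᵐᵒᵖ Q]

variable (Q) in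
theorem projective_finite_Dr : Module.Projective A (Dr A Q) ∧ Module.Finite A (Dr A Q) := by
  obtain ⟨n, b, φ, h⟩ := exists_finite_dual_basis_right (A := A) Q
  exact projective_finite_of_dual_basis φ (fun i => evalR A Q (b i)) (sum_smul_dual_basis h)

variable (A Q) in
theorem evalR_bijective : Function.Bijective (evalR A Q) := by
  obtain ⟨n, b, φ, h⟩ := exists_finite_dual_basis_right (A := A) Q
  constructor
  · rw [← LinearMap.ker_eq_bot, eq_bot_iff]
    intro q hq
    have hq' : ∀ g : Dr A Q, g q = 0 := fun g => LinearMap.congr_fun (LinearMap.mem_ker.1 hq) g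
    rw [Submodule.mem_bot, ← h q]
    simp [hq']
  · intro x
    refine ⟨∑ i, MulOpposite.op (x (φ i)) • b i, ?_⟩
    ext g
    conv_rhs => rw [← sum_smul_dual_basis h g]
    simp [evalR]

theorem mem_radM_Dr {g : Dr A Q} (hg : ∀ q, g q ∈ Ring.jacobson A) : g ∈ radM A (Dr A Q) := by
  obtain ⟨n, b, φ, h⟩ := exists_finite_dual_basis_right (A := A) Q
  rw [← sum_smul_dual_basis h g]
  exact Submodule.sum_mem _ fun i _ => Ring.jacobson_smul_top_le A (Dr A Q)
    (Submodule.smul_mem_smul (hg _) trivial)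

end Right

theorem apply_mem_jacobson_of_mem_radM {P : Type u} [AddCommGroup P] [Module A P] (g : Dl A P)
    {p : P} (hp : p ∈ radM A P) : g p ∈ Ring.jacobson A :=
  Module.le_comap_jacobson g hp

theorem apply_mem_jacobson_of_mem_radM_right [IsArtinianRing A] [IsArtinianRing Aᵐᵒᵖ]
    {Q : Type u} [AddCommGroup Q] [Module Aᵐᵒᵖ Q] (g : Dr A Q)
    {q : Q} (hq : q ∈ radM Aᵐᵒᵖ Q) : g q ∈ Ring.jacobson A :=
  op_mem_jacobson_iff.1 (Module.le_comap_jacobson ((opRegular A).toLinearMap.comp g) hq)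

theorem eq_bot_of_dual_le_jacobson [IsArtinianRing A] [IsArtinianRing Aᵐᵒᵖ]
    {Q : Type u} [AddCommGroup Q] [Module Aᵐᵒᵖ Q] [Module.Projective Aᵐᵒᵖ Q]
    [Module.Finite Aᵐᵒᵖ Q] (h : ∀ (g : Dr A Q) q, g q ∈ Ring.jacobson A) :
    (⊤ : Submodule Aᵐᵒᵖ Q) = ⊥ := by
  obtain ⟨n, b, φ, hb⟩ := exists_finite_dual_basis_right (A := A) Q
  refine Submodule.FG.eq_bot_of_le_jacobson_smul Module.Finite.fg_top fun q _ => ?_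
  rw [← hb q]
  exact Submodule.sum_mem _ fun i _ =>
    Submodule.smul_mem_smul (op_mem_jacobson_iff.2 (h _ _)) trivial

/-- On a reduced right module, all functionals take values in the Jacobson radical. -/
theorem apply_mem_jacobson_of_reduced [IsArtinianRing A] [IsArtinianRing Aᵐᵒᵖ]
    {Z : Type u} [AddCommGroup Z] [Module Aᵐᵒᵖ Z] [Module.Finite Aᵐᵒᵖ Z]
    (hZ : Reduced Aᵐᵒᵖ Z) (g : Dr A Z) (z : Z) : g z ∈ Ring.jacobson A := by
  rw [← op_mem_jacobson_iff, mem_jacobson_iff_isNilpotent]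
  intro y
  have := isNilpotent_of_reduced hZ ((opRegular A).toLinearMap.comp g) (y • z)
  rwa [map_smul] at this

section Transpose

variable {P₁ P₀ M Q₁ Q₀ Z : Type u}
  [AddCommGroup P₁] [Module A P₁] [AddCommGroup P₀] [Module A P₀] [AddCommGroup M] [Module A M]
  [AddCommGroup Q₁] [Module Aᵐᵒᵖ Q₁] [AddCommGroup Q₀] [Module Aᵐᵒᵖ Q₀]
  [AddCommGroup Z] [Module Aᵐᵒᵖ Z]

theorem isTrR_of_isMinPres [IsArtinianRing A] [IsArtinianRing Aᵐᵒᵖ]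
    {f : P₁ →ₗ[A] P₀} {e : P₀ →ₗ[A] M} (h : IsMinPres A f e)
    (hk : ker (dualMapL f) ≤ radM Aᵐᵒᵖ (Dl A P₀))
    (θ : Z ≃ₗ[Aᵐᵒᵖ] (Dl A P₁ ⧸ range (dualMapL f))) : IsTrR A Z M := by
  obtain ⟨⟨_, _, hs, hr⟩, hfe, _, _, -⟩ := h
  refine ⟨ModuleCat.of _ (Dl A P₀), ModuleCat.of _ (Dl A P₁), dualMapL f,
    θ.symm.toLinearMap.comp (Submodule.mkQ _), ⟨⟨(projective_finite_Dl P₁).1,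
      (projective_finite_Dl P₁).2, θ.symm.surjective.comp (Submodule.mkQ_surjective _), ?_⟩, ?_,
      (projective_finite_Dl P₀).1, (projective_finite_Dl P₀).2, hk⟩, ⟨?_⟩⟩
  · rw [LinearEquiv.ker_comp, Submodule.ker_mkQ]
    rintro _ ⟨g, rfl⟩
    exact mem_radM_Dl fun p => apply_mem_jacobson_of_mem_radM g (hr (hfe ▸ ⟨p, rfl⟩))
  · rw [LinearEquiv.ker_comp, Submodule.ker_mkQ]
  · refine (e.quotKerEquivOfSurjective hs).symm.trans ((Submodule.quotEquivOfEq _ _ hfe.symm).trans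
      (Submodule.Quotient.equiv _ _ (LinearEquiv.ofBijective _ (evalL_bijective A P₀)) ?_))
    have hc : (evalL A P₀).comp f = (dualMapR (dualMapL f)).comp (evalL A P₁) := rfl
    change (range f).map (evalL A P₀) = _
    rw [← LinearMap.range_comp, hc]
    exact LinearMap.range_comp_of_range_eq_top _
      (LinearMap.range_eq_top.2 (evalL_bijective A P₁).2)

theorem isTrL_of_isMinPres [IsArtinianRing A] [IsArtinianRing Aᵐᵒᵖ]
    {d : Q₁ →ₗ[Aᵐᵒᵖ] Q₀} {c : Q₀ →ₗ[Aᵐᵒᵖ] Z} (h : IsMinPres Aᵐᵒᵖ d c)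
    (hk : ker (dualMapR d) ≤ radM A (Dr A Q₀))
    (θ : M ≃ₗ[A] (Dr A Q₁ ⧸ range (dualMapR d))) : IsTrL A M Z := by
  obtain ⟨⟨_, _, hs, hr⟩, hfe, _, _, -⟩ := h
  refine ⟨ModuleCat.of _ (Dr A Q₀), ModuleCat.of _ (Dr A Q₁), dualMapR d,
    θ.symm.toLinearMap.comp (Submodule.mkQ _), ⟨⟨(projective_finite_Dr Q₁).1,
      (projective_finite_Dr Q₁).2, θ.symm.surjective.comp (Submodule.mkQ_surjective _), ?_⟩, ?_,
      (projective_finite_Dr Q₀).1, (projective_finite_Dr Q₀).2, hk⟩, ⟨?_⟩⟩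
  · rw [LinearEquiv.ker_comp, Submodule.ker_mkQ]
    rintro _ ⟨g, rfl⟩
    exact mem_radM_Dr fun p => apply_mem_jacobson_of_mem_radM_right g (hr (hfe ▸ ⟨p, rfl⟩))
  · rw [LinearEquiv.ker_comp, Submodule.ker_mkQ]
  · refine (c.quotKerEquivOfSurjective hs).symm.trans ((Submodule.quotEquivOfEq _ _ hfe.symm).trans
      (Submodule.Quotient.equiv _ _ (LinearEquiv.ofBijective _ (evalR_bijective A Q₀)) ?_))
    have hc : (evalR A Q₀).comp d = (dualMapL (dualMapR d)).comp (evalR A Q₁) := rfl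
    change (range d).map (evalR A Q₀) = _
    rw [← LinearMap.range_comp, hc]
    exact LinearMap.range_comp_of_range_eq_top _
      (LinearMap.range_eq_top.2 (evalR_bijective A Q₁).2)

/-- The transpose of a left module is unique up to isomorphism. -/
theorem nonempty_equiv_of_isTrL [IsNoetherianRing A] {Z' : Type u} [AddCommGroup Z']
    [Module Aᵐᵒᵖ Z'] (h : IsTrL A M Z) (h' : IsTrL A M Z') : Nonempty (Z ≃ₗ[Aᵐᵒᵖ] Z') := by
  obtain ⟨P₁, P₀, f, e, hf, ⟨θ⟩⟩ := h
  obtain ⟨P₁', P₀', f', e', hf', ⟨θ'⟩⟩ := h'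
  obtain ⟨α, β, hαβ⟩ := exists_equiv_of_isMinPres hf hf'
  let α' : Dl A P₁ ≃ₗ[Aᵐᵒᵖ] Dl A P₁' :=
    LinearEquiv.ofLinearMap (dualMapL α.symm.toLinearMap) (dualMapL α.toLinearMap)
      (by ext; simp [dualMapL]) (by ext; simp [dualMapL])
  refine ⟨θ.trans ((Submodule.Quotient.equiv _ _ α' ?_).trans θ'.symm)⟩
  ext g
  constructor
  · rintro ⟨_, ⟨x, rfl⟩, rfl⟩
    refine ⟨dualMapL β.symm.toLinearMap x, ?_⟩
    ext p
    obtain ⟨p, rfl⟩ := α.surjective p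
    simp [α', dualMapL, ← hαβ]
  · rintro ⟨x, rfl⟩
    refine ⟨_, ⟨dualMapL β.toLinearMap x, rfl⟩, ?_⟩
    ext p
    obtain ⟨p, rfl⟩ := α.surjective p
    simp [α', dualMapL, ← hαβ]

/-- The transpose of a right module is unique up to isomorphism. -/
theorem nonempty_equiv_of_isTrR [IsNoetherianRing Aᵐᵒᵖ] {M' : Type u} [AddCommGroup M']
    [Module A M'] (h : IsTrR A Z M) (h' : IsTrR A Z M') : Nonempty (M ≃ₗ[A] M') := by
  obtain ⟨Q₁, Q₀, d, c, hd, ⟨θ⟩⟩ := h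
  obtain ⟨Q₁', Q₀', d', c', hd', ⟨θ'⟩⟩ := h'
  obtain ⟨α, β, hαβ⟩ := exists_equiv_of_isMinPres hd hd'
  let α' : Dr A Q₁ ≃ₗ[A] Dr A Q₁' :=
    LinearEquiv.ofLinearMap (dualMapR α.symm.toLinearMap) (dualMapR α.toLinearMap)
      (by ext; simp [dualMapR]) (by ext; simp [dualMapR])
  refine ⟨θ.trans ((Submodule.Quotient.equiv _ _ α' ?_).trans θ'.symm)⟩
  ext g
  constructor
  · rintro ⟨_, ⟨x, rfl⟩, rfl⟩
    refine ⟨dualMapR β.symm.toLinearMap x, ?_⟩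
    ext p
    obtain ⟨p, rfl⟩ := α.surjective p
    simp [α', dualMapR, ← hαβ]
  · rintro ⟨x, rfl⟩
    refine ⟨_, ⟨dualMapR β.toLinearMap x, rfl⟩, ?_⟩
    ext p
    obtain ⟨p, rfl⟩ := α.surjective p
    simp [α', dualMapR, ← hαβ]

/-- The cokernel of the dual of a minimal presentation is reduced. -/
theorem reduced_of_isMinPres [IsArtinianRing A] [IsArtinianRing Aᵐᵒᵖ]
    {f : P₁ →ₗ[A] P₀} {e : P₀ →ₗ[A] M} (h : IsMinPres A f e)
    (θ : Z ≃ₗ[Aᵐᵒᵖ] (Dl A P₁ ⧸ range (dualMapL f))) : Reduced Aᵐᵒᵖ Z := by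
  obtain ⟨⟨_, _, -, -⟩, -, _, _, hk⟩ := h
  intro N N' hN hproj
  let q := θ.symm.toLinearMap.comp (Submodule.mkQ (range (dualMapL f)))
  have hq : Function.Surjective q := θ.symm.surjective.comp (Submodule.mkQ_surjective _)
  let π := (N.projectionOnto N' hN).comp q
  have hπ : Function.Surjective π := (Submodule.projectionOnto_surjective hN).comp hq
  have := (projective_finite_Dl (A := A) P₁).2
  have : Module.Finite Aᵐᵒᵖ N := Module.Finite.of_surjective π hπ
  have htop := eq_bot_of_dual_le_jacobson (A := A) (Q := N) fun g x => by
    obtain ⟨y, rfl⟩ := hπ x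
    obtain ⟨p, hp⟩ := (evalL_bijective A P₁).2 (g.comp π)
    have hp' : ∀ w : Dl A P₁, w p = g (π w) := fun w => LinearMap.congr_fun hp w
    rw [← hp']
    refine apply_mem_jacobson_of_mem_radM y (hk ?_)
    refine (evalL_bijective A P₀).1 ?_
    rw [map_zero]
    ext w
    have hw : q (dualMapL f w) = 0 := by
      simp only [q, LinearMap.comp_apply]
      rw [(LinearMap.mem_ker.1 (by rw [Submodule.ker_mkQ]; exact ⟨w, rfl⟩) :
        (range (dualMapL f)).mkQ (dualMapL f w) = 0), map_zero]
    have := hp' (dualMapL f w)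
    simp only [π, LinearMap.comp_apply, hw, map_zero] at this
    exact this
  rw [eq_bot_iff]
  intro x hx
  exact congrArg Subtype.val ((Submodule.mem_bot Aᵐᵒᵖ).1 (htop ▸ trivial : (⟨x, hx⟩ : N) ∈ _))

theorem ker_dualMapL_eq_bot {f : P₁ →ₗ[A] P₀} {e : P₀ →ₗ[A] M} (he : Function.Surjective e)
    (h : range f = ker e) (hM : ∀ g : Dl A M, g = 0) : ker (dualMapL f) = ⊥ := by
  rw [eq_bot_iff]
  intro g hg
  have hle : ker e ≤ ker g := by
    rw [← h]
    rintro _ ⟨x, rfl⟩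
    exact LinearMap.congr_fun (LinearMap.mem_ker.1 hg) x
  have h0 := hM (((ker e).liftQ g hle).comp (e.quotKerEquivOfSurjective he).symm.toLinearMap)
  rw [Submodule.mem_bot]
  ext p
  have := LinearMap.congr_fun h0 (e p)
  have hs : (e.quotKerEquivOfSurjective he).symm (e p) = (ker e).mkQ p :=
    (LinearEquiv.symm_apply_eq _).2 rfl
  simpa [hs] using this

theorem tfPd1Class_of_isTrL [IsArtinianRing A] [IsArtinianRing Aᵐᵒᵖ] (hM : NunkeClass A M)
    (h : IsTrL A M Z) : TfPd1Class A Z ∧ IsTrR A Z M := by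
  obtain ⟨-, hG, hM0⟩ := hM
  obtain ⟨P₁, P₀, f, e, hf, ⟨θ⟩⟩ := h
  have hk : ker (dualMapL f) = ⊥ := ker_dualMapL_eq_bot hf.1.2.2.1 hf.2.1 hM0
  have hTr : IsTrR A Z M := isTrR_of_isMinPres hf (hk ▸ bot_le) θ
  have hred := reduced_of_isMinPres hf θ
  obtain ⟨⟨_, _, -, -⟩, -, _, _, -⟩ := hf
  have := projective_finite_Dl (A := A) P₁
  have hP := (projective_finite_Dl (A := A) P₀).1
  have hs : Function.Surjective (θ.symm.toLinearMap.comp (range (dualMapL f)).mkQ) :=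
    θ.symm.surjective.comp (Submodule.mkQ_surjective _)
  have := this.2
  refine ⟨⟨Module.Finite.of_surjective _ hs, hred, ⟨ModuleCat.of A M, hTr, hG⟩,
    ModuleCat.of _ (Dl A P₁), θ.symm.toLinearMap.comp (range (dualMapL f)).mkQ,
    (projective_finite_Dl P₁).1, this, hs, ?_⟩, hTr⟩
  change Module.Projective _ (ker (θ.symm.toLinearMap.comp (range (dualMapL f)).mkQ))
  rw [LinearEquiv.ker_comp, Submodule.ker_mkQ]
  exact Module.Projective.of_equiv (LinearEquiv.ofInjective _ (LinearMap.ker_eq_bot.1 hk))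

theorem nunkeClass_of_isTrR [IsNoetherianRing Aᵐᵒᵖ] (hZ : TfPd1Class A Z) (h : IsTrR A Z M) :
    NunkeClass A M := by
  obtain ⟨-, -, ⟨M', hM', hG⟩, hpd⟩ := hZ
  obtain ⟨φ⟩ := nonempty_equiv_of_isTrR hM' h
  obtain ⟨Q₁, Q₀, d, c, hd, ⟨θ⟩⟩ := h
  have hinj := ker_eq_bot_of_isMinPres_of_projDimLE_one hd hpd
  obtain ⟨⟨_, _, -, -⟩, -, _, _, -⟩ := hd
  have := (projective_finite_Dr (A := A) Q₁).2
  have hs : Function.Surjective (θ.symm.toLinearMap.comp (range (dualMapR d)).mkQ) :=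
    θ.symm.surjective.comp (Submodule.mkQ_surjective _)
  refine ⟨Module.Finite.of_surjective _ hs, sGp_of_equiv φ hG, fun g => ?_⟩
  obtain ⟨q, hq⟩ := (evalR_bijective A Q₁).2
    (g.comp (θ.symm.toLinearMap.comp (range (dualMapR d)).mkQ))
  have hq' : ∀ w : Dr A Q₁, w q = g (θ.symm ((range (dualMapR d)).mkQ w)) :=
    fun w => LinearMap.congr_fun hq w
  have hdq : d q = 0 := by
    refine (evalR_bijective A Q₀).1 ?_
    rw [map_zero]
    ext w
    have hw : (range (dualMapR d)).mkQ (dualMapR d w) = 0 :=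
      (Submodule.Quotient.mk_eq_zero _).2 ⟨w, rfl⟩
    have := hq' (dualMapR d w)
    rw [hw, map_zero, map_zero] at this
    exact this
  have hq0 : q = 0 := (Submodule.mem_bot Aᵐᵒᵖ).1 (hinj ▸ hdq)
  ext m
  obtain ⟨w, rfl⟩ := hs m
  have := hq' w
  rw [hq0, map_zero] at this
  exact this.symm

theorem isTrL_of_isTrR [IsArtinianRing A] [IsArtinianRing Aᵐᵒᵖ] [Module.Finite Aᵐᵒᵖ Z]
    (hZ : Reduced Aᵐᵒᵖ Z) (h : IsTrR A Z M) : IsTrL A M Z := by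
  obtain ⟨Q₁, Q₀, d, c, hd, ⟨θ⟩⟩ := h
  refine isTrL_of_isMinPres hd (fun g hg => ?_) θ
  obtain ⟨⟨_, _, hs, -⟩, hr, -⟩ := hd
  refine mem_radM_Dr fun q => ?_
  have hle : ker c ≤ ker g := by
    rw [← hr]
    rintro _ ⟨x, rfl⟩
    exact LinearMap.congr_fun (LinearMap.mem_ker.1 hg) x
  have := apply_mem_jacobson_of_reduced hZ
    (((ker c).liftQ g hle).comp (c.quotKerEquivOfSurjective hs).symm.toLinearMap) (c q)
  have hs : (c.quotKerEquivOfSurjective hs).symm (c q) = (ker c).mkQ q :=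
    (LinearEquiv.symm_apply_eq _).2 rfl
  simpa [hs] using this

end Transpose

end Duality

/-- Proposition 3.3 (second part): `Tr` is a bijection between the iso classes of Nunke
modules and the iso classes of reduced ∞-torsionfree right modules of projective
dimension at most 1. -/
theorem transpose_bijection_nunke (k : Type u) [CommRing k] [IsArtinianRing k]
    (A : Type u) [Ring A] [Algebra k A] [Module.Finite k A] :
    (∀ M : ModuleCat.{u} A, NunkeClass A (↥M) →
      ∀ Z : ModuleCat.{u} Aᵐᵒᵖ, IsTrL A (↥M) (↥Z) → TfPd1Class A (↥Z)) ∧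
    (∀ Z : ModuleCat.{u} Aᵐᵒᵖ, TfPd1Class A (↥Z) →
      ∀ M : ModuleCat.{u} A, IsTrR A (↥Z) (↥M) → NunkeClass A (↥M)) ∧
    (∀ M : ModuleCat.{u} A, NunkeClass A (↥M) →
      ∀ Z : ModuleCat.{u} Aᵐᵒᵖ, IsTrL A (↥M) (↥Z) →
        ∀ M' : ModuleCat.{u} A, IsTrR A (↥Z) (↥M') → Nonempty ((↥M') ≃ₗ[A] (↥M))) ∧
    (∀ Z : ModuleCat.{u} Aᵐᵒᵖ, TfPd1Class A (↥Z) →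
      ∀ M : ModuleCat.{u} A, IsTrR A (↥Z) (↥M) →
        ∀ Z' : ModuleCat.{u} Aᵐᵒᵖ, IsTrL A (↥M) (↥Z') → Nonempty ((↥Z') ≃ₗ[Aᵐᵒᵖ] (↥Z))) := by
  have : IsArtinianRing A := .of_finite k A
  have : Module.Finite k Aᵐᵒᵖ := Module.Finite.equiv (MulOpposite.opLinearEquiv k)
  have : IsArtinianRing Aᵐᵒᵖ := .of_finite k Aᵐᵒᵖ
  refine ⟨fun M hM Z h => (tfPd1Class_of_isTrL hM h).1, fun Z hZ M h => nunkeClass_of_isTrR hZ h,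
    fun M hM Z h M' h' => nonempty_equiv_of_isTrR h' (tfPd1Class_of_isTrL hM h).2,
    fun Z hZ M h Z' h' => ?_⟩
  have := hZ.1
  exact nonempty_equiv_of_isTrL h' (isTrL_of_isTrR hZ.2.1 h)
end

section
/- Suppose there is a bound b with the following property: every finitely generated right A-module of finite projective dimension has projective dimension at most b (i.e., the finitistic dimension of A^op is finite). Then every semi-Gorenstein-projective left A-module M such that M* has finite projective dimension is projective. -/
/-!
Common background: `A` is an artin algebra (an algebra over a commutative artinian
ring `k`, finitely generated as `k`-module).  Left `A`-modules are `Module A M`;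
right `A`-modules are `Module Aᵐᵒᵖ N`.  `Dl A M = Hom_A(M,A)` is the `A`-dual of a
left module (a right module) and `Dr A N` the dual of a right module (a left module);
`evalL A M : M → M**` is the canonical evaluation map `φ_M`.
-/

open CategoryTheory LinearMap

universe u

section Auxiliary

variable {A : Type u} [Ring A]

lemma subsingleton_ext_of_extZero {M N : Type u} [AddCommGroup M] [Module A M]
    [AddCommGroup N] [Module A N] {n : ℕ} (h : extZero A M N (n + 1)) :
    Subsingleton (Abelian.Ext.{u} (ModuleCat.of A M) (ModuleCat.of A N) (n + 1)) := by
  refine subsingleton_of_forall_eq 0 fun x => ?_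
  obtain ⟨R⟩ : Nonempty (ProjectiveResolution (ModuleCat.of A M)) := HasProjectiveResolution.out
  obtain ⟨f, hf, rfl⟩ := R.extMk_surjective x (n + 2) rfl
  rw [R.extMk_eq_zero_iff f (n + 2) rfl hf n rfl]
  have hz := h.of_iso (R.isoExt (R := ℤ) (n + 1) (ModuleCat.of A N)).symm
  rw [← HomologicalComplex.exactAt_iff_isZero_homology,
    HomologicalComplex.exactAt_iff' _ n (n + 1) (n + 2) (by simp) (by simp),
    ShortComplex.moduleCat_exact_iff] at hz
  exact hz f hf

lemma projDimLEcat_of_linearEquiv {n : ℕ} {X Y : ModuleCat.{u} A} (e : X ≃ₗ[A] Y)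
    (h : projDimLEcat A n X) : projDimLEcat A n Y := by
  cases n with
  | zero =>
    have : Module.Projective A X := h
    exact Module.Projective.of_equiv e
  | succ n =>
    obtain ⟨P, p, hP, hPf, hp, hk⟩ := h
    refine ⟨P, e.toLinearMap ∘ₗ p, hP, hPf, e.surjective.comp hp, ?_⟩
    rwa [LinearEquiv.ker_comp]

lemma hasProjectiveDimensionLT_of_projDimLEcat {n : ℕ} :
    ∀ {X : ModuleCat.{u} A}, projDimLEcat A n X → HasProjectiveDimensionLT X (n + 1) := by
  induction n with
  | zero =>
    intro X h
    have : Module.Projective A X := h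
    infer_instance
  | succ n ih =>
    rintro X ⟨P, p, hP, -, hp, hk⟩
    exact (LinearMap.shortExact_shortComplexKer hp).hasProjectiveDimensionLT_X₃ (n + 1) (ih hk)
      (inferInstanceAs (HasProjectiveDimensionLT P (n + 2)))

lemma dualMapL_injective {M N : Type u} [AddCommGroup M] [Module A M] [AddCommGroup N]
    [Module A N] {p : M →ₗ[A] N} (hp : Function.Surjective p) :
    Function.Injective (dualMapL p) := fun _ _ h =>
  LinearMap.ext fun n => by
    obtain ⟨m, rfl⟩ := hp n
    exact LinearMap.congr_fun h m

lemma dualMapL_exact {M N : Type u} [AddCommGroup M] [Module A M] [AddCommGroup N]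
    [Module A N] {p : M →ₗ[A] N} (hp : Function.Surjective p) :
    Function.Exact (dualMapL p) (dualMapL (ker p).subtype) := by
  intro f
  constructor
  · intro h
    have hk : ker p ≤ ker f := fun x hx => LinearMap.congr_fun h ⟨x, hx⟩
    refine ⟨(ker p).liftQ f hk ∘ₗ (p.quotKerEquivOfSurjective hp).symm.toLinearMap, ?_⟩
    ext x
    change (ker p).liftQ f hk ((p.quotKerEquivOfSurjective hp).symm (p x)) = f x
    have : (p.quotKerEquivOfSurjective hp).symm (p x) = Submodule.Quotient.mk x := by
      rw [LinearEquiv.symm_apply_eq]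
      rfl
    rw [this]
    rfl
  · rintro ⟨g, rfl⟩
    ext ⟨x, hx⟩
    change g (p x) = 0
    rw [LinearMap.mem_ker.1 hx, map_zero]

/-- The right regular module is isomorphic to `Aᵐᵒᵖ`. -/
def rightRegularEquiv : Aᵐᵒᵖ ≃ₗ[Aᵐᵒᵖ] A where
  toFun := MulOpposite.unop
  invFun := MulOpposite.op
  left_inv _ := rfl
  right_inv _ := rfl
  map_add' _ _ := rfl
  map_smul' _ _ := rfl

/-- The dual of a free left module of rank `n` is the free right module of rank `n`. -/
def dualPiEquiv (n : ℕ) : (Fin n → A) ≃ₗ[Aᵐᵒᵖ] Dl A (Fin n → A) where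
  toFun v := ∑ i, (LinearMap.proj i).smulRight (v i)
  invFun f i := f (Pi.single i 1)
  left_inv v := by
    ext i
    simp [Pi.single_apply]
  right_inv f := by
    ext i
    simp [Pi.single_apply]
  map_add' v w := by
    ext i
    simp [Pi.single_apply]
  map_smul' a v := by
    ext i
    simp [Pi.single_apply]

instance projective_dual_pi (n : ℕ) : Module.Projective Aᵐᵒᵖ (Dl A (Fin n → A)) :=
  Module.Projective.of_equiv
    ((LinearEquiv.piCongrRight fun _ => rightRegularEquiv) ≪≫ₗ dualPiEquiv (A := A) n)

instance finite_dual_pi (n : ℕ) : Module.Finite Aᵐᵒᵖ (Dl A (Fin n → A)) :=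
  Module.Finite.equiv
    ((LinearEquiv.piCongrRight fun _ => rightRegularEquiv) ≪≫ₗ dualPiEquiv (A := A) n)

lemma evalL_pi_surjective (n : ℕ) : Function.Surjective (evalL A (Fin n → A)) := by
  intro ψ
  refine ⟨fun i => ψ (LinearMap.proj i), ?_⟩
  ext f
  have hf : f = ∑ i, MulOpposite.op (f (Pi.single i 1)) • LinearMap.proj (φ := fun _ => A) i := by
    ext i
    simp [Pi.single_apply]
  rw [hf]
  simp [evalL]

lemma evalL_injective_of_le_pi {n : ℕ} (K : Submodule A (Fin n → A)) :
    Function.Injective (evalL A K) := by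
  intro x y h
  ext i
  exact LinearMap.congr_fun h (LinearMap.proj i ∘ₗ K.subtype)

/-- Finitely generated modules `M` with `Ext^i(M, A) = 0` for all `i ≥ 1`, whose dual has finite
projective dimension. -/
def SgpWithDualFinitePD (M : Type u) [AddCommGroup M] [Module A M] : Prop :=
  Module.Finite A M ∧
    (∀ i : ℕ, Subsingleton (Abelian.Ext.{u} (ModuleCat.of A M) (ModuleCat.of A A) (i + 1))) ∧
    ∃ n, projDimLE Aᵐᵒᵖ (Dl A M) n

section Cover

variable {M : Type u} [AddCommGroup M] [Module A M] {n : ℕ} {p : (Fin n → A) →ₗ[A] M}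

lemma dualMapL_subtype_surjective (hM : SgpWithDualFinitePD (A := A) M)
    (hp : Function.Surjective p) : Function.Surjective (dualMapL (ker p).subtype) := by
  intro f
  have := hM.2.1 0
  obtain ⟨x, hx⟩ := Abelian.Ext.contravariant_sequence_exact₁
    (LinearMap.shortExact_shortComplexKer hp) (ModuleCat.of A A)
    (Abelian.Ext.mk₀ (ModuleCat.ofHom f)) (n₁ := 1) rfl (this.elim _ _)
  obtain ⟨g, rfl⟩ := (Abelian.Ext.mk₀_bijective _ _).2 x
  rw [Abelian.Ext.mk₀_comp_mk₀] at hx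
  have := (Abelian.Ext.mk₀_bijective _ _).1 hx
  exact ⟨g.hom, congrArg ModuleCat.Hom.hom this⟩

lemma SgpWithDualFinitePD.ker [IsNoetherianRing A] (hM : SgpWithDualFinitePD (A := A) M)
    (hp : Function.Surjective p) : SgpWithDualFinitePD (A := A) (ker p) := by
  refine ⟨inferInstance, fun i => subsingleton_of_forall_eq 0 fun x => ?_, ?_⟩
  · have hS := LinearMap.shortExact_shortComplexKer hp
    have h_proj : Projective (ModuleCat.of A (Fin n → A)) := inferInstance
    have := hM.2.1 (i + 1)
    obtain ⟨y, rfl⟩ := Abelian.Ext.contravariant_sequence_exact₁ hS _ x (n₁ := i + 2)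
      (by omega) (this.elim _ _)
    rw [Abelian.Ext.eq_zero_of_projective y, Abelian.Ext.comp_zero]
  · obtain ⟨m, hm⟩ := hM.2.2
    refine ⟨m + 1, ModuleCat.of Aᵐᵒᵖ (Dl A (Fin n → A)), dualMapL (LinearMap.ker p).subtype,
      projective_dual_pi n, finite_dual_pi n, dualMapL_subtype_surjective hM hp, ?_⟩
    refine projDimLEcat_of_linearEquiv ?_ hm
    exact (LinearEquiv.ofInjective _ (dualMapL_injective hp)) ≪≫ₗ
      LinearEquiv.ofEq _ _ (LinearMap.exact_iff.1 (dualMapL_exact hp)).symm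

end Cover

lemma projective_dual_of_forall_hasProjectiveDimensionLT [IsNoetherianRing A] (n : ℕ)
    (h : ∀ (M : Type u) [AddCommGroup M] [Module A M], SgpWithDualFinitePD (A := A) M →
      HasProjectiveDimensionLT (ModuleCat.of Aᵐᵒᵖ (Dl A M)) (n + 1))
    (M : Type u) [AddCommGroup M] [Module A M] (hM : SgpWithDualFinitePD (A := A) M) :
    Module.Projective Aᵐᵒᵖ (Dl A M) := by
  induction n generalizing M with
  | zero =>
    rw [IsProjective.iff_projective, projective_iff_hasProjectiveDimensionLT_one]
    exact h M hM
  | succ n ih =>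
    refine ih (fun M _ _ hM => ?_) M hM
    have := hM.1
    obtain ⟨m, p, hp⟩ := Module.Finite.exists_fin' A M
    have hS := ModuleCat.shortComplex_shortExact
      (ModuleCat.shortComplexOfCompEqZero (dualMapL p) (dualMapL (ker p).subtype)
        (dualMapL_exact hp).linearMap_comp_eq_zero)
      (dualMapL_exact hp) (dualMapL_injective hp) (dualMapL_subtype_surjective hM hp)
    exact hS.hasProjectiveDimensionLT_X₁ (n + 1)
      (inferInstanceAs (HasProjectiveDimensionLT
        (ModuleCat.of Aᵐᵒᵖ (Dl A (Fin m → A))) (n + 1)))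
      (h _ (hM.ker hp))

lemma evalL_surjective_of_projective_dual_ker {M : Type u} [AddCommGroup M] [Module A M] {n : ℕ}
    {p : (Fin n → A) →ₗ[A] M} (hp : Function.Surjective p)
    (hs : Function.Surjective (dualMapL (ker p).subtype))
    [Module.Projective Aᵐᵒᵖ (Dl A (ker p))] : Function.Surjective (evalL A M) := by
  obtain ⟨s, hs⟩ := Module.projective_lifting_property _ LinearMap.id hs
  have h_split := (dualMapL_exact hp).split_tfae'.out 0 1
  obtain ⟨-, r, hr⟩ := h_split.1 ⟨dualMapL_injective hp, s, hs⟩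
  intro ψ
  obtain ⟨v, hv⟩ := evalL_pi_surjective n (ψ ∘ₗ r)
  refine ⟨p v, ?_⟩
  ext f
  have h₁ := LinearMap.congr_fun hv (dualMapL p f)
  have h₂ := LinearMap.congr_fun hr f
  simp only [LinearMap.comp_apply, LinearMap.id_apply] at h₁ h₂
  rw [h₂] at h₁
  exact h₁

lemma SgpWithDualFinitePD.projective [IsNoetherianRing A] {M : Type u} [AddCommGroup M]
    [Module A M] (hM : SgpWithDualFinitePD (A := A) M)
    (h : ∀ (M : Type u) [AddCommGroup M] [Module A M], SgpWithDualFinitePD (A := A) M →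
      Module.Projective Aᵐᵒᵖ (Dl A M)) : Module.Projective A M := by
  have := hM.1
  obtain ⟨n, p, hp⟩ := Module.Finite.exists_fin' A M
  have hK := hM.ker hp
  have := hK.1
  obtain ⟨m, q, hq⟩ := Module.Finite.exists_fin' A (LinearMap.ker p)
  have := h _ hK
  have := h _ (hK.ker hq)
  let e := LinearEquiv.ofBijective (evalL A (LinearMap.ker p)) ⟨evalL_injective_of_le_pi _,
    evalL_surjective_of_projective_dual_ker hq (dualMapL_subtype_surjective hK hq)⟩
  obtain ⟨s, hs⟩ := Module.projective_lifting_property _ LinearMap.id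
    (dualMapL_subtype_surjective hM hp)
  let r : (Fin n → A) →ₗ[A] LinearMap.ker p :=
    e.symm.toLinearMap ∘ₗ dualMapR s ∘ₗ evalL A (Fin n → A)
  have hr : r ∘ₗ (LinearMap.ker p).subtype = LinearMap.id := by
    ext1 x
    refine (LinearEquiv.symm_apply_eq e).2 ?_
    ext f
    exact LinearMap.congr_fun (LinearMap.congr_fun hs f) x
  have h_split := (LinearMap.exact_subtype_ker_map p).split_tfae'.out 0 1
  obtain ⟨-, l, hl⟩ := h_split.2 ⟨hp, r, hr⟩
  exact Module.Projective.of_split l p hl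

end Auxiliary

/-- Proposition 3.5, (1) ⟹ (2): if the finitistic dimension of `A^op` is bounded by `b`,
then every semi-Gorenstein-projective module `M` whose dual has finite projective
dimension is projective. -/
theorem finitistic_dim_implies_sgp_projective (k : Type u) [CommRing k] [IsArtinianRing k]
    (A : Type u) [Ring A] [Algebra k A] [Module.Finite k A] (b : ℕ)
    (hb : ∀ N : ModuleCat.{u} Aᵐᵒᵖ, Module.Finite Aᵐᵒᵖ (↥N) →
      (∃ n, projDimLE Aᵐᵒᵖ (↥N) n) → projDimLE Aᵐᵒᵖ (↥N) b)
    (M : Type u) [AddCommGroup M] [Module A M] [Module.Finite A M]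
    (hsgp : sGp A M) (hfpd : ∃ n, projDimLE Aᵐᵒᵖ (Dl A M) n) :
    Module.Projective A M := by
  have : IsNoetherianRing A := IsNoetherianRing.of_finite k A
  have : Module.Finite k Aᵐᵒᵖ := Module.Finite.equiv (MulOpposite.opLinearEquiv k)
  have : IsNoetherianRing Aᵐᵒᵖ := IsNoetherianRing.of_finite k Aᵐᵒᵖ
  have hM : SgpWithDualFinitePD (A := A) M :=
    ⟨inferInstance, fun i => subsingleton_ext_of_extZero (hsgp (i + 1) (by omega)), hfpd⟩
  refine hM.projective (projective_dual_of_forall_hasProjectiveDimensionLT b fun N _ _ hN => ?_)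
  have := hN.1
  obtain ⟨n, p, hp⟩ := Module.Finite.exists_fin' A N
  have : Module.Finite Aᵐᵒᵖ (Dl A N) :=
    Module.Finite.of_injective (dualMapL p) (dualMapL_injective hp)
  exact hasProjectiveDimensionLT_of_projDimLEcat (hb (ModuleCat.of Aᵐᵒᵖ (Dl A N)) this hN.2.2)
end
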